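/- Let m ≥ 2 be an integer, h > 0 and p ∈ ℝ, and put λ = exp(2πi·h·p) ∈ ℂ. If E_{2m-2}(λ) ≠ 0, then the series ∑_{β∈ℤ} D_m[β]·exp(2πi·h·p·β) converges absolutely and (as an identity in ℂ) ∑_{β∈ℤ} D_m[β]·exp(2πi·h·p·β) = ((2m−1)!/h^{2m}) · (1−λ)^{2m}/(λ·E_{2m-2}(λ)). -/

import Mathlib

/-- The Euler–Frobenius coefficient `a_s^{(k)}`. -/
noncomputable def eulerCoeff (k s : ℕ) : ℝ :=
  ∑ j ∈ Finset.range (s + 1),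
    (-1 : ℝ) ^ j * (Nat.choose (k + 2) j : ℝ) * ((s + 1 - j : ℕ) : ℝ) ^ (k + 1)

/-- The Euler–Frobenius polynomial `E_k`. -/
noncomputable def eulerPoly (k : ℕ) : Polynomial ℝ :=
  ∑ s ∈ Finset.range (k + 1), Polynomial.C (eulerCoeff k s) * Polynomial.X ^ s

/-- The set `Λ` of real roots of `E_{2m-2}` of modulus less than `1`. -/
noncomputable def smallRoots (m : ℕ) : Finset ℝ :=
  (eulerPoly (2 * m - 2)).roots.toFinset.filter (fun x => |x| < 1)

/-- The discrete analogue `D_m[β]` of the operator `d^{2m}/dx^{2m}`. -/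
noncomputable def Dm (m : ℕ) (h : ℝ) (β : ℤ) : ℝ :=
  (((2 * m - 1).factorial : ℝ) / h ^ (2 * m)) *
    (if β = 0 then
      -(2 : ℝ) ^ (2 * m - 1) +
        ∑ l ∈ smallRoots m, (1 - l) ^ (2 * m + 1) / (l * (eulerPoly (2 * m - 1)).eval l)
    else if β.natAbs = 1 then
      1 + ∑ l ∈ smallRoots m, (1 - l) ^ (2 * m + 1) / (eulerPoly (2 * m - 1)).eval l
    else
      ∑ l ∈ smallRoots m,
        (1 - l) ^ (2 * m + 1) * l ^ β.natAbs / (l * (eulerPoly (2 * m - 1)).eval l))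

/-- The Euler–Frobenius polynomial `E_k` over `ℂ`. -/
noncomputable def eulerPolyC (k : ℕ) : Polynomial ℂ :=
  ∑ s ∈ Finset.range (k + 1),
    Polynomial.C (∑ j ∈ Finset.range (s + 1),
      (-1 : ℂ) ^ j * (Nat.choose (k + 2) j : ℂ) * ((s + 1 - j : ℕ) : ℂ) ^ (k + 1)) *
      Polynomial.X ^ s

open Polynomial

lemma eulerCoeff_zero_right (k : ℕ) : eulerCoeff k 0 = 1 := by
  simp [eulerCoeff]

lemma eulerCoeff_one_right (k : ℕ) : eulerCoeff k 1 = 2 ^ (k + 1) - (k + 2) := by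
  simp [eulerCoeff, Finset.sum_range_succ]
  ring

lemma eulerCoeff_succ_succ (k s : ℕ) :
    eulerCoeff (k + 1) (s + 1) =
      (s + 2) * eulerCoeff k (s + 1) + (k + 1 - s) * eulerCoeff k s := by
  unfold eulerCoeff
  rw [Finset.sum_range_succ' _ (s + 1), Finset.sum_range_succ' _ (s + 1), mul_add,
    Finset.mul_sum, Finset.mul_sum, add_right_comm (Finset.sum _ _) _ (Finset.sum _ _),
    ← Finset.sum_add_distrib]
  congr 1
  · refine Finset.sum_congr rfl fun j hj => ?_
    have hj' : j ≤ s + 1 := by grind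
    have e : s + 1 + 1 - (j + 1) = s + 1 - j := by omega
    rw [e, Nat.cast_sub hj']
    have h1 : ((k + 1 + 2).choose (j + 1) : ℝ) =
        (k + 2).choose j + (k + 2).choose (j + 1) := by
      rw [← Nat.cast_add, ← Nat.choose_succ_succ]
    have h2 : ((k + 1 + 2).choose (j + 1) : ℝ) * (j + 1) = (k + 3) * (k + 2).choose j := by
      have := Nat.add_one_mul_choose_eq (k + 2) j
      have h3 : ((k + 2 + 1 : ℕ) : ℝ) * (k + 2).choose j =
          ((k + 2 + 1).choose (j + 1) : ℝ) * ((j + 1 : ℕ) : ℝ) := by exact_mod_cast this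
      push_cast at h3
      rw [show k + 1 + 2 = k + 2 + 1 by ring, ← h3]
      ring
    push_cast
    linear_combination (-1 : ℝ) ^ (j + 1) * ((s : ℝ) + 1 - j) ^ (k + 1) *
      ((s + 2) * h1 - h2)
  · simp
    ring

lemma eulerCoeff_eq_zero {k s : ℕ} (h : k < s) : eulerCoeff k s = 0 := by
  induction k generalizing s with
  | zero =>
    obtain ⟨s, rfl⟩ : ∃ t, s = t + 1 := ⟨s - 1, by omega⟩
    rcases s with _ | s
    · simp [eulerCoeff, Finset.sum_range_succ]
    · unfold eulerCoeff
      rw [Finset.sum_range_succ', Finset.sum_range_succ', Finset.sum_range_succ',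
        Finset.sum_eq_zero]
      · simp
        ring
      · intro j _
        rw [Nat.choose_eq_zero_of_lt (by omega)]
        simp
  | succ k ih =>
    obtain ⟨s, rfl⟩ : ∃ t, s = t + 1 := ⟨s - 1, by omega⟩
    rw [eulerCoeff_succ_succ, ih (by omega), ih (by omega)]
    simp

lemma eulerCoeff_symm {k s t : ℕ} (h : s + t = k) : eulerCoeff k s = eulerCoeff k t := by
  induction k generalizing s t with
  | zero =>
    obtain ⟨rfl, rfl⟩ : s = 0 ∧ t = 0 := by omega
    rfl
  | succ k ih =>
    have last : eulerCoeff (k + 1) (k + 1) = 1 := by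
      rw [eulerCoeff_succ_succ, eulerCoeff_eq_zero (lt_add_one k), ih (t := 0) (by simp),
        eulerCoeff_zero_right]
      ring
    rcases s with _ | s
    · obtain rfl : t = k + 1 := by omega
      rw [last, eulerCoeff_zero_right]
    rcases t with _ | t
    · obtain rfl : s = k := by omega
      rw [last, eulerCoeff_zero_right]
    rw [eulerCoeff_succ_succ, eulerCoeff_succ_succ, ih (s := s + 1) (t := t) (by omega),
      ih (s := s) (t := t + 1) (by omega)]
    have : (s : ℝ) + t + 1 = k := by exact_mod_cast (by omega : s + t + 1 = k)
    rw [← this]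
    ring

lemma eulerCoeff_self (k : ℕ) : eulerCoeff k k = 1 := by
  rw [eulerCoeff_symm (t := 0) (by simp), eulerCoeff_zero_right]

lemma coeff_eulerPoly (k s : ℕ) : (eulerPoly k).coeff s = eulerCoeff k s := by
  simp only [eulerPoly, finsetSum_coeff, coeff_C_mul, coeff_X_pow, mul_ite, mul_one, mul_zero,
    Finset.sum_ite_eq, Finset.mem_range]
  split_ifs with h
  · rfl
  · rw [eulerCoeff_eq_zero (by omega)]

lemma eulerPoly_zero : eulerPoly 0 = 1 := by
  simp [eulerPoly, eulerCoeff_zero_right]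

lemma eval_zero_eulerPoly (k : ℕ) : (eulerPoly k).eval 0 = 1 := by
  rw [← coeff_zero_eq_eval_zero, coeff_eulerPoly, eulerCoeff_zero_right]

lemma eulerPoly_ne_zero (k : ℕ) : eulerPoly k ≠ 0 := fun h => by
  simpa [h] using eval_zero_eulerPoly k

lemma natDegree_eulerPoly (k : ℕ) : (eulerPoly k).natDegree = k := by
  refine natDegree_eq_of_le_of_coeff_ne_zero ?_ ?_
  · exact natDegree_le_iff_coeff_eq_zero.2 fun N hN => by
      rw [coeff_eulerPoly, eulerCoeff_eq_zero hN]
  · rw [coeff_eulerPoly, eulerCoeff_self]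
    exact one_ne_zero

lemma monic_eulerPoly (k : ℕ) : (eulerPoly k).Monic := by
  rw [Monic, leadingCoeff, natDegree_eulerPoly, coeff_eulerPoly, eulerCoeff_self]

lemma eulerPoly_succ (k : ℕ) :
    eulerPoly (k + 1) =
      (1 + C (k + 1 : ℝ) * X) * eulerPoly k + X * (1 - X) * derivative (eulerPoly k) := by
  have hX : ∀ n : ℕ, (X * derivative (eulerPoly k)).coeff n = n * eulerCoeff k n := by
    rintro (_ | n)
    · simp
    · rw [coeff_X_mul, coeff_derivative, coeff_eulerPoly]
      push_cast
      ring
  have e : (1 + C (k + 1 : ℝ) * X) * eulerPoly k + X * (1 - X) * derivative (eulerPoly k) =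
      eulerPoly k + C (k + 1 : ℝ) * (X * eulerPoly k) +
        (X * derivative (eulerPoly k) - X * (X * derivative (eulerPoly k))) := by ring
  rw [e]
  ext n
  simp only [coeff_add, coeff_sub, coeff_C_mul, hX, coeff_eulerPoly]
  rcases n with _ | n
  · simp [eulerCoeff_zero_right]
  · simp only [coeff_X_mul, hX, coeff_eulerPoly, eulerCoeff_succ_succ]
    push_cast
    ring

lemma eval_eulerPoly_succ (k : ℕ) (x : ℝ) :
    (eulerPoly (k + 1)).eval x =
      (1 + (k + 1) * x) * (eulerPoly k).eval x +
        x * (1 - x) * (derivative (eulerPoly k)).eval x := by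
  simp [eulerPoly_succ]

lemma eval_one_eulerPoly_ne_zero (k : ℕ) : (eulerPoly k).eval 1 ≠ 0 := by
  induction k with
  | zero => simp [eulerPoly_zero]
  | succ k ih =>
    rw [eval_eulerPoly_succ]
    simp only [mul_one, sub_self, mul_zero, zero_mul, add_zero]
    exact mul_ne_zero (by positivity) ih

lemma eval_eulerPoly_inv (k : ℕ) {x : ℝ} (hx : x ≠ 0) :
    (eulerPoly k).eval x⁻¹ * x ^ k = (eulerPoly k).eval x := by
  rw [eval_eq_sum_range, eval_eq_sum_range, natDegree_eulerPoly, Finset.sum_mul,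
    ← Finset.sum_range_reflect]
  refine Finset.sum_congr rfl fun j hj => ?_
  have hj' : j ≤ k := by grind
  rw [coeff_eulerPoly, coeff_eulerPoly, eulerCoeff_symm (s := k + 1 - 1 - j) (t := j) (by omega)]
  have : x ^ k = x ^ (k + 1 - 1 - j) * x ^ j := by rw [← pow_add]; congr 1; omega
  rw [this, inv_pow]
  field_simp

/-- The polynomial `(u (u - 1) d/du)^k (u (u - 1))`, which is `∑ i ^ (k + 1) x ^ i` in the
variable `u = 1 / (1 - x)`. -/
noncomputable def powerSumPoly : ℕ → ℝ[X]
  | 0 => X * (X - 1)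
  | k + 1 => X * (X - 1) * derivative (powerSumPoly k)

lemma eval_powerSumPoly (k : ℕ) {u : ℝ} (hu : u ≠ 0) :
    (powerSumPoly k).eval u = u ^ (k + 1) * (u - 1) * (eulerPoly k).eval (1 - u⁻¹) := by
  induction k generalizing u with
  | zero => simp [powerSumPoly, eulerPoly_zero]
  | succ k ih =>
    have h1 : HasDerivAt (fun v : ℝ => v ^ (k + 1) * (v - 1) * (eulerPoly k).eval (1 - v⁻¹))
        ((derivative (powerSumPoly k)).eval u) u := by
      refine ((powerSumPoly k).hasDerivAt u).congr_of_eventuallyEq ?_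
      filter_upwards [isOpen_ne.mem_nhds hu] with v hv using (ih hv).symm
    have h2 := ((hasDerivAt_pow (k + 1) u).mul ((hasDerivAt_id u).sub_const 1)).mul
      (((eulerPoly k).hasDerivAt (1 - u⁻¹)).comp u ((hasDerivAt_inv hu).const_sub 1))
    have h3 := h1.unique h2
    simp only [powerSumPoly, eval_mul, eval_X, eval_sub, eval_one, h3, eval_eulerPoly_succ]
    simp
    field_simp
    ring

lemma card_roots_powerSumPoly (k : ℕ) :
    0 ∈ (powerSumPoly k).roots.toFinset ∧ 1 ∈ (powerSumPoly k).roots.toFinset ∧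
      k + 2 ≤ (powerSumPoly k).roots.toFinset.card := by
  induction k with
  | zero =>
    have h0 : powerSumPoly 0 ≠ 0 := mul_ne_zero X_ne_zero (X_sub_C_ne_zero (1 : ℝ))
    have h1 : (0 : ℝ) ∈ (powerSumPoly 0).roots.toFinset := by
      simp [h0]; simp [powerSumPoly]
    have h2 : (1 : ℝ) ∈ (powerSumPoly 0).roots.toFinset := by
      simp [h0]; simp [powerSumPoly]
    refine ⟨h1, h2, ?_⟩
    exact Finset.one_lt_card.2 ⟨0, h1, 1, h2, zero_ne_one⟩
  | succ k ih =>
    obtain ⟨h0, h1, hc⟩ := ih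
    have hr := card_roots_toFinset_le_card_roots_derivative_sdiff_roots_succ (powerSumPoly k)
    set T := (derivative (powerSumPoly k)).roots.toFinset \ (powerSumPoly k).roots.toFinset
      with hT
    have hd : derivative (powerSumPoly k) ≠ 0 := fun h => by
      simp [hT, h] at hr
      omega
    have hX : (X * (X - 1) : ℝ[X]) ≠ 0 := mul_ne_zero X_ne_zero (X_sub_C_ne_zero (1 : ℝ))
    have hne : powerSumPoly (k + 1) ≠ 0 := mul_ne_zero hX hd
    have hsub : insert 0 (insert 1 T) ⊆ (powerSumPoly (k + 1)).roots.toFinset := by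
      intro x hx
      rw [Multiset.mem_toFinset, mem_roots hne, IsRoot, powerSumPoly, eval_mul]
      simp only [Finset.mem_insert] at hx
      rcases hx with rfl | rfl | hx
      · simp
      · simp
      · rw [hT, Finset.mem_sdiff, Multiset.mem_toFinset, mem_roots hd] at hx
        rw [hx.1, mul_zero]
    refine ⟨hsub (by simp), hsub (by simp), le_trans ?_ (Finset.card_le_card hsub)⟩
    have h1T : (1 : ℝ) ∉ T := fun h => (Finset.mem_sdiff.1 h).2 h1
    have h0T : (0 : ℝ) ∉ insert 1 T := fun h => by
      rcases Finset.mem_insert.1 h with h | h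
      · exact zero_ne_one h
      · exact (Finset.mem_sdiff.1 h).2 h0
    rw [Finset.card_insert_of_notMem h0T, Finset.card_insert_of_notMem h1T]
    omega

lemma card_roots_eulerPoly (k : ℕ) : (eulerPoly k).roots.toFinset.card = k := by
  refine le_antisymm ?_ ?_
  · calc _ ≤ Multiset.card (eulerPoly k).roots := Multiset.toFinset_card_le _
      _ ≤ _ := card_roots' _
      _ = k := natDegree_eulerPoly k
  · obtain ⟨h0, h1, hc⟩ := card_roots_powerSumPoly k
    have hne : powerSumPoly k ≠ 0 := fun h => by simp [h] at h0
    set T := ((powerSumPoly k).roots.toFinset.erase 0).erase 1 with hT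
    have hcT : k ≤ T.card := by
      rw [hT, Finset.card_erase_of_mem (by simpa using h1), Finset.card_erase_of_mem h0]
      omega
    refine hcT.trans (Finset.card_le_card_of_injOn (fun u => 1 - u⁻¹) ?_ ?_)
    · intro u hu
      simp only [hT, Finset.coe_erase, Set.mem_sdiff, Finset.mem_coe, Multiset.mem_toFinset,
        mem_roots hne, Set.mem_singleton_iff] at hu
      obtain ⟨⟨hr, hu0⟩, hu1⟩ := hu
      rw [IsRoot, eval_powerSumPoly k hu0] at hr
      simp only [Finset.mem_coe, Multiset.mem_toFinset, mem_roots (eulerPoly_ne_zero k)]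
      have : u ^ (k + 1) * (u - 1) ≠ 0 := mul_ne_zero (pow_ne_zero _ hu0) (sub_ne_zero.2 hu1)
      exact (mul_eq_zero.1 hr).resolve_left this
    · intro u _ v _ huv
      simpa using huv

lemma eulerPoly_eq_nodal (k : ℕ) :
    eulerPoly k = Lagrange.nodal (eulerPoly k).roots.toFinset id := by
  have hnd : (eulerPoly k).roots.Nodup := by
    rw [← Multiset.toFinset_card_eq_card_iff_nodup]
    refine le_antisymm (Multiset.toFinset_card_le _) ?_
    rw [card_roots_eulerPoly]
    exact (card_roots' _).trans (natDegree_eulerPoly k).le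
  have hcard : Multiset.card (eulerPoly k).roots = (eulerPoly k).natDegree := by
    rw [← Multiset.toFinset_card_of_nodup hnd, card_roots_eulerPoly, natDegree_eulerPoly]
  have := prod_multiset_X_sub_C_of_monic_of_roots_card_eq (monic_eulerPoly k) hcard
  conv_lhs => rw [← this]
  rw [Lagrange.nodal, Finset.prod, Multiset.toFinset_val, hnd.dedup]
  rfl

/-- The residue of `(1 - x) ^ (k + 2) / (x E_k(x))` at a root `x` of `E_k`. -/
noncomputable def eulerResidue (k : ℕ) (x : ℝ) : ℝ :=
  (1 - x) ^ (k + 3) / (eulerPoly (k + 1)).eval x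

lemma eulerResidue_inv (k : ℕ) (hk : Even k) {x : ℝ} (hx : x ≠ 0) :
    eulerResidue k x⁻¹ = -(eulerResidue k x / x ^ 2) := by
  have h := eval_eulerPoly_inv (k + 1) hx
  have h1 : (1 - x⁻¹) ^ (k + 3) * x ^ (k + 3) = -(1 - x) ^ (k + 3) := by
    have ho : Odd (k + 3) := by grind
    rw [← mul_pow, sub_mul, inv_mul_cancel₀ hx, one_mul, ← ho.neg_pow, neg_sub]
  have h2 : (1 - x⁻¹) ^ (k + 3) = -(1 - x) ^ (k + 3) / x ^ (k + 3) := by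
    rw [← h1]; field_simp
  unfold eulerResidue
  rw [← h, h2]
  by_cases h0 : (eulerPoly (k + 1)).eval x⁻¹ = 0
  · simp [h0]
  · field_simp
    ring

lemma mem_roots_eulerPoly {k : ℕ} {x : ℝ} :
    x ∈ (eulerPoly k).roots.toFinset ↔ (eulerPoly k).eval x = 0 := by
  rw [Multiset.mem_toFinset, mem_roots (eulerPoly_ne_zero k), IsRoot]

lemma ne_zero_of_mem_roots_eulerPoly {k : ℕ} {x : ℝ} (hx : x ∈ (eulerPoly k).roots.toFinset) :
    x ≠ 0 := by
  rintro rfl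
  rw [mem_roots_eulerPoly, eval_zero_eulerPoly] at hx
  exact one_ne_zero hx

lemma inv_mem_roots_eulerPoly {k : ℕ} {x : ℝ} (hx : x ∈ (eulerPoly k).roots.toFinset) :
    x⁻¹ ∈ (eulerPoly k).roots.toFinset := by
  have h0 := ne_zero_of_mem_roots_eulerPoly hx
  rw [mem_roots_eulerPoly] at hx ⊢
  rw [← eval_eulerPoly_inv k h0] at hx
  exact (mul_eq_zero.1 hx).resolve_right (pow_ne_zero _ h0)

open Classical in
lemma roots_eulerPoly_eq_union (k : ℕ) (hk : Even k) :
    (eulerPoly k).roots.toFinset = (eulerPoly k).roots.toFinset.filter (fun x => |x| < 1) ∪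
      ((eulerPoly k).roots.toFinset.filter (fun x => |x| < 1)).image (fun x => x⁻¹) := by
  set R := (eulerPoly k).roots.toFinset with hR
  set S := R.filter (fun x => |x| < 1) with hS
  have hsub : S ∪ S.image (fun x => x⁻¹) ⊆ R := by
    refine Finset.union_subset (Finset.filter_subset _ _) ?_
    intro x hx
    obtain ⟨y, hy, rfl⟩ := Finset.mem_image.1 hx
    exact inv_mem_roots_eulerPoly (Finset.mem_filter.1 hy).1
  have hdisj : Disjoint S (S.image (fun x => x⁻¹)) := by
    rw [Finset.disjoint_left]
    intro x hx hx'
    obtain ⟨y, hy, rfl⟩ := Finset.mem_image.1 hx'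
    have h1 := (Finset.mem_filter.1 hx).2
    have hy := Finset.mem_filter.1 hy
    have := (one_lt_inv₀ (abs_pos.2 (ne_zero_of_mem_roots_eulerPoly hy.1))).2 hy.2
    rw [abs_inv] at h1
    linarith
  have hcard : (S ∪ S.image (fun x => x⁻¹)).card = 2 * S.card := by
    rw [Finset.card_union_of_disjoint hdisj, Finset.card_image_of_injective _ inv_injective]
    ring
  have hle : R ⊆ insert (-1) (S ∪ S.image (fun x => x⁻¹)) := by
    intro x hx
    rcases lt_trichotomy |x| 1 with h | h | h
    · exact Finset.mem_insert_of_mem (Finset.mem_union_left _ (Finset.mem_filter.2 ⟨hx, h⟩))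
    · rcases eq_or_eq_neg_of_abs_eq h with rfl | rfl
      · exact absurd (mem_roots_eulerPoly.1 hx) (eval_one_eulerPoly_ne_zero k)
      · exact Finset.mem_insert_self _ _
    · refine Finset.mem_insert_of_mem (Finset.mem_union_right _ (Finset.mem_image.2
        ⟨x⁻¹, Finset.mem_filter.2 ⟨inv_mem_roots_eulerPoly hx, ?_⟩, inv_inv x⟩))
      rw [abs_inv]
      exact inv_lt_one_of_one_lt₀ h
  have h1 := Finset.card_le_card hsub
  have h2 := (Finset.card_le_card hle).trans (Finset.card_insert_le _ _)
  have hRc : R.card = k := card_roots_eulerPoly k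
  exact (Finset.eq_of_subset_of_card_le hsub (by grind)).symm

lemma sum_roots_eulerPoly {M : Type*} [AddCommMonoid M] (k : ℕ) (hk : Even k) (f : ℝ → M) :
    ∑ x ∈ (eulerPoly k).roots.toFinset, f x =
      ∑ x ∈ (eulerPoly k).roots.toFinset.filter (fun x => |x| < 1), (f x + f x⁻¹) := by
  classical
  conv_lhs => rw [roots_eulerPoly_eq_union k hk]
  rw [Finset.sum_union, Finset.sum_image (fun _ _ _ _ h => inv_injective h),
    Finset.sum_add_distrib]
  rw [Finset.disjoint_left]
  intro x hx hx'
  obtain ⟨y, hy, rfl⟩ := Finset.mem_image.1 hx'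
  have h1 := (Finset.mem_filter.1 hx).2
  have hy := Finset.mem_filter.1 hy
  have := (one_lt_inv₀ (abs_pos.2 (ne_zero_of_mem_roots_eulerPoly hy.1))).2 hy.2
  rw [abs_inv] at h1
  linarith

lemma degree_sub_X_mul_eulerPoly_lt (k : ℕ) (hk : Even k) (hk1 : 1 ≤ k) :
    ((1 - X) ^ (k + 2) - (X - C (2 ^ (k + 1))) * (X * eulerPoly k)).degree <
      ((k + 1 : ℕ) : WithBot ℕ) := by
  have hp : ((1 - X) ^ (k + 2) : ℝ[X]) = (X + C (-1)) ^ (k + 2) := by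
    have he : Even (k + 2) := by grind
    rw [← he.neg_pow]
    congr 1
    simp
    ring
  have hE : (X - C ((2 : ℝ) ^ (k + 1))) * (X * eulerPoly k) =
      X * (X * eulerPoly k) - C (2 ^ (k + 1)) * (X * eulerPoly k) := by ring
  rw [hp, hE, degree_lt_iff_coeff_zero]
  intro n hn
  obtain ⟨n, rfl⟩ : ∃ l, n = l + 2 := ⟨n - 2, by omega⟩
  simp only [coeff_sub, coeff_X_add_C_pow, coeff_C_mul, coeff_X_mul, coeff_eulerPoly]
  rcases lt_trichotomy n k with h | rfl | h
  · obtain rfl : k = n + 1 := by omega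
    rw [eulerCoeff_symm (s := n) (t := 1) rfl, eulerCoeff_self, eulerCoeff_one_right]
    have : (n + 1 + 2).choose (n + 2) = n + 3 := Nat.choose_succ_self_right (n + 2)
    rw [this, show n + 1 + 2 - (n + 2) = 1 by omega]
    push_cast
    ring
  · rw [eulerCoeff_self, eulerCoeff_eq_zero (lt_add_one n)]
    simp
  · rw [eulerCoeff_eq_zero h, eulerCoeff_eq_zero (by omega : k < n + 1),
      Nat.choose_eq_zero_of_lt (by omega)]
    simp

lemma eulerPolyC_eq_map (k : ℕ) : eulerPolyC k = (eulerPoly k).map Complex.ofRealHom := by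
  simp [eulerPolyC, eulerPoly, eulerCoeff, Polynomial.map_sum]

lemma nodal_insert_zero_roots (k : ℕ) :
    Lagrange.nodal (insert 0 (eulerPoly k).roots.toFinset) (fun x : ℝ => (x : ℂ)) =
      (X * eulerPoly k).map Complex.ofRealHom := by
  have h0 : (0 : ℝ) ∉ (eulerPoly k).roots.toFinset := fun h => ne_zero_of_mem_roots_eulerPoly h rfl
  rw [Lagrange.nodal_insert_eq_nodal h0, Polynomial.map_mul]
  conv_rhs => rw [eulerPoly_eq_nodal]
  simp [Lagrange.nodal, Polynomial.map_prod]

lemma partial_fractions_eulerPoly (k : ℕ) (hk : Even k) (hk1 : 1 ≤ k) {z : ℂ} (hz : z ≠ 0)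
    (hE : (eulerPolyC k).eval z ≠ 0) :
    (1 - z) ^ (k + 2) / (z * (eulerPolyC k).eval z) =
      z - 2 ^ (k + 1) + z⁻¹ +
        ∑ x ∈ (eulerPoly k).roots.toFinset, (eulerResidue k x : ℂ) * (z - x)⁻¹ := by
  have h0 : (0 : ℝ) ∉ (eulerPoly k).roots.toFinset := fun h => ne_zero_of_mem_roots_eulerPoly h rfl
  set N : ℝ[X] := (1 - X) ^ (k + 2) - (X - C (2 ^ (k + 1))) * (X * eulerPoly k) with hN
  set s := insert 0 (eulerPoly k).roots.toFinset with hs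
  have hnodal := nodal_insert_zero_roots k
  rw [← hs] at hnodal
  have hdeg : (N.map Complex.ofRealHom).degree < s.card := by
    rw [hs, Finset.card_insert_of_notMem h0, card_roots_eulerPoly]
    exact degree_map_le.trans_lt (degree_sub_X_mul_eulerPoly_lt k hk hk1)
  have hinj : Set.InjOn (fun x : ℝ => (x : ℂ)) s := Complex.ofReal_injective.injOn
  have hne : ∀ x ∈ s, z ≠ (x : ℂ) := by
    rintro x hx rfl
    rcases Finset.mem_insert.1 hx with rfl | hx
    · simp at hz
    · rw [mem_roots_eulerPoly] at hx
      apply hE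
      rw [eulerPolyC_eq_map]
      exact (eval_map_apply (f := Complex.ofRealHom) x).trans (by simp [hx])
  have hev (q : ℝ[X]) (x : ℝ) :
      (q.map Complex.ofRealHom).eval (x : ℂ) = ((q.eval x : ℝ) : ℂ) :=
    eval_map_apply (f := Complex.ofRealHom) x
  have hint := congrArg (eval z) (Lagrange.eq_interpolate hinj hdeg)
  rw [Lagrange.eval_interpolate_not_at_node _ hne, hnodal, hs, Finset.sum_insert h0, ← hs] at hint
  have hweight : ∀ x ∈ s, Lagrange.nodalWeight s (fun x : ℝ => (x : ℂ)) x =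
      (((eulerPoly k).eval x + x * (derivative (eulerPoly k)).eval x : ℝ) : ℂ)⁻¹ := by
    intro x hx
    rw [Lagrange.nodalWeight_eq_eval_derivative_nodal hx, hnodal, derivative_map, hev]
    simp
  have hres : ∀ x ∈ (eulerPoly k).roots.toFinset,
      Lagrange.nodalWeight s (fun x : ℝ => (x : ℂ)) x * (z - x)⁻¹ *
        (N.map Complex.ofRealHom).eval (x : ℂ) = (eulerResidue k x : ℂ) * (z - x)⁻¹ := by
    intro x hx
    rw [hweight x (Finset.mem_insert_of_mem hx), hev, mul_right_comm]
    congr 1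
    rw [← Complex.ofReal_inv, ← Complex.ofReal_mul]
    congr 1
    rw [mem_roots_eulerPoly] at hx
    have h1 : 1 - x ≠ 0 := fun h => eval_one_eulerPoly_ne_zero k <| by
      rwa [← sub_eq_zero.1 h] at hx
    rw [eulerResidue, eval_eulerPoly_succ, hx, mul_zero, zero_add, zero_add,
      show x * (1 - x) * (derivative (eulerPoly k)).eval x =
        (1 - x) * (x * (derivative (eulerPoly k)).eval x) by ring, pow_succ',
      mul_div_mul_left _ _ h1, div_eq_inv_mul]
    simp [hN, hx]
  rw [Finset.sum_congr rfl hres, hweight 0 (by simp [hs]), hev] at hint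
  have hNz : (N.map Complex.ofRealHom).eval z =
      (1 - z) ^ (k + 2) - (z - 2 ^ (k + 1)) * (z * (eulerPolyC k).eval z) := by
    simp [hN, eulerPolyC_eq_map]
  rw [hNz, Polynomial.map_mul, eval_mul, ← eulerPolyC_eq_map, eval_zero_eulerPoly] at hint
  have hN0 : N.eval 0 = 1 := by simp [hN]
  rw [hN0] at hint
  simp only [map_X, eval_X, zero_mul, add_zero, Complex.ofReal_one, inv_one, one_mul,
    Complex.ofReal_zero, sub_zero, mul_one] at hint
  rw [div_eq_iff (mul_ne_zero hz hE)]
  linear_combination hint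

lemma hasSum_pow_natAbs_mul_zpow {x z : ℂ} (hx : ‖x‖ < 1) (hz : ‖z‖ = 1) :
    HasSum (fun β : ℤ => x ^ β.natAbs * z ^ β) ((1 - x * z)⁻¹ + x * (z - x)⁻¹) := by
  have hz0 : z ≠ 0 := norm_ne_zero_iff.1 (by simp [hz])
  refine HasSum.of_nat_of_neg_add_one ?_ ?_
  · have := hasSum_geometric_of_norm_lt_one (ξ := x * z) (by simpa [hz] using hx)
    exact this.congr_fun fun n => by simp [mul_pow]
  · have := (hasSum_geometric_of_norm_lt_one (ξ := x * z⁻¹) (by simpa [hz] using hx)).mul_left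
      (x * z⁻¹)
    have hzx : z - x ≠ 0 := by
      intro h0
      rw [← sub_eq_zero.1 h0, hz] at hx
      exact lt_irrefl _ hx
    have e : x * z⁻¹ * (1 - x * z⁻¹)⁻¹ = x * (z - x)⁻¹ := by
      rw [mul_assoc, ← mul_inv, mul_sub, mul_one, mul_left_comm, mul_inv_cancel₀ hz0, mul_one]
    rw [e] at this
    refine this.congr_fun fun n => ?_
    have en : (-((n : ℤ) + 1)).natAbs = n + 1 := by omega
    rw [en, ← pow_succ', mul_pow, inv_pow, zpow_neg]
    norm_cast

lemma hasSum_ite_zpow (a z : ℂ) :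
    HasSum (fun β : ℤ => (if β = 0 then a else if β.natAbs = 1 then 1 else 0) * z ^ β)
      (z + a + z⁻¹) := by
  have h : HasSum (fun β : ℤ => (if β = 0 then a else if β.natAbs = 1 then 1 else 0) * z ^ β)
      (∑ β ∈ ({-1, 0, 1} : Finset ℤ),
        (if β = 0 then a else if β.natAbs = 1 then 1 else 0) * z ^ β) := by
    refine hasSum_sum_of_ne_finset_zero fun β hβ => ?_
    have h0 : β ≠ 0 := by grind
    have h1 : β.natAbs ≠ 1 := by grind
    simp [h0, h1]
  convert h using 1
  simp
  ring

lemma Dm_eq (n : ℕ) (h : ℝ) (β : ℤ) :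
    Dm (n + 1) h β = (((2 * (n + 1) - 1).factorial : ℝ) / h ^ (2 * (n + 1))) *
      ((if β = 0 then -2 ^ (2 * n + 1) else if β.natAbs = 1 then 1 else 0) +
        ∑ l ∈ smallRoots (n + 1), eulerResidue (2 * n) l / l * l ^ β.natAbs) := by
  have e1 : 2 * (n + 1) - 1 = 2 * n + 1 := by omega
  have hl : ∀ l ∈ smallRoots (n + 1), l ≠ 0 := fun l hl =>
    ne_zero_of_mem_roots_eulerPoly (Finset.mem_filter.1 hl).1
  unfold Dm
  rw [e1]
  congr 1
  split_ifs with h0 h1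
  · congr 1
    refine Finset.sum_congr rfl fun l hl' => ?_
    simp [h0, eulerResidue, div_div, mul_add, mul_comm l]
  · congr 1
    refine Finset.sum_congr rfl fun l hl' => ?_
    rw [h1, pow_one, div_mul_cancel₀ _ (hl l hl')]
    rfl
  · rw [zero_add]
    refine Finset.sum_congr rfl fun l hl' => ?_
    have := hl l hl'
    simp only [eulerResidue, div_div, mul_add, mul_one]
    rw [div_mul_eq_mul_div, mul_comm l]

theorem Dm_fourier_series (m : ℕ) (hm : 2 ≤ m) (h p : ℝ) (hh : 0 < h)
    (hE : (eulerPolyC (2 * m - 2)).eval (Complex.exp (2 * Real.pi * Complex.I * h * p)) ≠ 0) :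
    Summable (fun β : ℤ =>
      (Dm m h β : ℂ) * Complex.exp (2 * Real.pi * Complex.I * h * p * β)) ∧
    ∑' β : ℤ, (Dm m h β : ℂ) * Complex.exp (2 * Real.pi * Complex.I * h * p * β) =
      (((2 * m - 1).factorial : ℂ) / (h : ℂ) ^ (2 * m)) *
        (1 - Complex.exp (2 * Real.pi * Complex.I * h * p)) ^ (2 * m) /
          (Complex.exp (2 * Real.pi * Complex.I * h * p) *
            (eulerPolyC (2 * m - 2)).eval (Complex.exp (2 * Real.pi * Complex.I * h * p))) := by
  set z := Complex.exp (2 * Real.pi * Complex.I * h * p) with hz_def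
  have hz : ‖z‖ = 1 := by
    rw [hz_def, show (2 * Real.pi * Complex.I * h * p : ℂ) =
      ((2 * Real.pi * h * p : ℝ) : ℂ) * Complex.I by push_cast; ring]
    exact Complex.norm_exp_ofReal_mul_I _
  have hz0 : z ≠ 0 := Complex.exp_ne_zero _
  have hexp (β : ℤ) : Complex.exp (2 * Real.pi * Complex.I * h * p * β) = z ^ β := by
    rw [mul_comm, Complex.exp_int_mul]
  obtain ⟨n, rfl⟩ : ∃ n, m = n + 1 := ⟨m - 1, by omega⟩
  have e2 : 2 * (n + 1) - 2 = 2 * n := by omega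
  rw [e2] at hE ⊢
  have hk : Even (2 * n) := even_two_mul n
  have hsum : HasSum (fun β : ℤ => (Dm (n + 1) h β : ℂ) * z ^ β)
      ((((2 * (n + 1) - 1).factorial : ℂ) / (h : ℂ) ^ (2 * (n + 1))) *
        ((z + -2 ^ (2 * n + 1) + z⁻¹) + ∑ l ∈ smallRoots (n + 1),
          (eulerResidue (2 * n) l / l : ℂ) * ((1 - l * z)⁻¹ + l * (z - l)⁻¹))) := by
    have h1 := hasSum_sum (s := smallRoots (n + 1)) fun l hl =>
      (hasSum_pow_natAbs_mul_zpow (x := (l : ℂ)) (z := z)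
        (by simpa using (Finset.mem_filter.1 hl).2) hz).mul_left
        (eulerResidue (2 * n) l / l : ℂ)
    refine (((hasSum_ite_zpow (-2 ^ (2 * n + 1)) z).add h1).mul_left _).congr_fun fun β => ?_
    rw [Dm_eq]
    push_cast
    simp only [← mul_assoc, ← Finset.sum_mul, ← add_mul]
    split_ifs <;> push_cast <;> rfl
  simp only [hexp]
  refine ⟨hsum.summable, hsum.tsum_eq.trans ?_⟩
  rw [mul_div_assoc]
  congr 1
  rw [show 2 * (n + 1) = 2 * n + 2 by ring,
    partial_fractions_eulerPoly (2 * n) hk (by omega) hz0 hE, ← sub_eq_add_neg,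
    sum_roots_eulerPoly _ hk]
  congr 1
  refine Finset.sum_congr (by rw [smallRoots, e2]) fun l hl => ?_
  have hl := Finset.mem_filter.1 hl
  have hl0 := ne_zero_of_mem_roots_eulerPoly hl.1
  have hl0' : (l : ℂ) ≠ 0 := by exact_mod_cast hl0
  have hlz : 1 - l * z ≠ 0 := by
    intro h0
    have h2 := congrArg norm (sub_eq_zero.1 h0)
    simp only [norm_one, norm_mul, hz, Complex.norm_real, Real.norm_eq_abs, mul_one] at h2
    linarith [hl.2]
  have hzl : z - (l : ℂ)⁻¹ = -((1 - l * z) / l) := by field_simp; ring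
  rw [eulerResidue_inv _ hk hl0]
  push_cast
  rw [hzl]
  field_simp
  ring
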